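/- The set F_lc of log-concave probability measures on ℝ is displacement convex, and for every p ∈ [1,∞), F_lc is closed in P_p(ℝ) with respect to the p-Wasserstein distance W_p. -/

import Mathlib

open MeasureTheory Set Filter

noncomputable def quantile (μ : MeasureTheory.Measure ℝ) (u : ℝ) : ℝ :=
  sInf {x : ℝ | u ≤ (μ (Set.Iic x)).toReal}

def HasFiniteMomentP (p : ℝ) (μ : MeasureTheory.Measure ℝ) : Prop :=
  MeasureTheory.IsProbabilityMeasure μ ∧
    MeasureTheory.Integrable (fun x => |x| ^ p) μ

noncomputable def Wdist (p : ℝ) (μ ν : MeasureTheory.Measure ℝ) : ℝ :=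
  (∫ u in Set.Ioo (0:ℝ) 1, |quantile μ u - quantile ν u| ^ p) ^ (1 / p)

def DisplacementConvex (F : Set (MeasureTheory.Measure ℝ)) : Prop :=
  ∀ μ ∈ F, ∀ ν ∈ F, ∀ t ∈ Set.Icc (0:ℝ) 1, ∃ σ ∈ F,
    ∀ u ∈ Set.Ioo (0:ℝ) 1,
      quantile σ u = (1 - t) * quantile μ u + t * quantile ν u

def WClosed (p : ℝ) (F : Set (MeasureTheory.Measure ℝ)) : Prop :=
  ∀ (μs : ℕ → MeasureTheory.Measure ℝ) (μ : MeasureTheory.Measure ℝ),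
    (∀ n, μs n ∈ F) → HasFiniteMomentP p μ →
    Filter.Tendsto (fun n => Wdist p (μs n) μ) Filter.atTop (nhds 0) → μ ∈ F

/-- A Borel probability measure on `ℝ` is log-concave if it is a point mass, or it has a
density `f` with respect to Lebesgue measure such that `log f : ℝ → [−∞, ∞)` is concave;
the latter is expressed by the multiplicative inequality
`f((1−t)x + ty) ≥ f(x)^(1−t) · f(y)^t`. -/
def IsLogConcave (μ : MeasureTheory.Measure ℝ) : Prop :=
  (∃ x : ℝ, μ = MeasureTheory.Measure.dirac x) ∨
  ∃ f : ℝ → ℝ, (∀ x, 0 ≤ f x) ∧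
    μ = MeasureTheory.volume.withDensity (fun x => ENNReal.ofReal (f x)) ∧
    ∀ x y : ℝ, ∀ t ∈ Set.Icc (0:ℝ) 1,
      f x ^ (1 - t) * f y ^ t ≤ f ((1 - t) * x + t * y)

/-- The set `F_lc` of log-concave probability measures on `ℝ`. -/
def Flc : Set (MeasureTheory.Measure ℝ) :=
  {μ | MeasureTheory.IsProbabilityMeasure μ ∧ IsLogConcave μ}

open ProbabilityTheory Topology

section Quantile

variable {μ : Measure ℝ} [IsProbabilityMeasure μ]

lemma quantile_le_iff {u x : ℝ} (hu : u ∈ Ioo (0 : ℝ) 1) : quantile μ u ≤ x ↔ u ≤ cdf μ x := by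
  have hS : {x : ℝ | u ≤ (μ (Iic x)).toReal} = {x | u ≤ cdf μ x} := by
    ext x
    simp [cdf_eq_real, measureReal_def]
  obtain ⟨b, hb⟩ := ((tendsto_cdf_atTop μ).eventually (lt_mem_nhds hu.2)).exists
  obtain ⟨a, ha⟩ := ((tendsto_cdf_atBot μ).eventually (gt_mem_nhds hu.1)).exists
  have hne : {x | u ≤ cdf μ x}.Nonempty := ⟨b, hb.le⟩
  have hbdd : BddBelow {x | u ≤ cdf μ x} :=
    ⟨a, fun y hy => le_of_lt ((monotone_cdf μ).reflect_lt (ha.trans_le hy))⟩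
  rw [quantile, hS]
  refine ⟨fun h => ?_, fun h => csInf_le hbdd h⟩
  refine le_trans ?_ (monotone_cdf μ h)
  have hcont : Tendsto (cdf μ) (𝓝[>] (sInf {x | u ≤ cdf μ x})) (𝓝 _) :=
    ((cdf μ).right_continuous _).mono_left (nhdsWithin_mono _ Ioi_subset_Ici_self)
  refine ge_of_tendsto hcont ?_
  filter_upwards [self_mem_nhdsWithin] with y hy
  obtain ⟨z, hz, hzy⟩ := exists_lt_of_csInf_lt hne hy
  exact le_trans hz (monotone_cdf μ hzy.le)

lemma lt_quantile_iff {u x : ℝ} (hu : u ∈ Ioo (0 : ℝ) 1) : x < quantile μ u ↔ cdf μ x < u := by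
  rw [← not_le, quantile_le_iff hu, not_le]

lemma le_cdf_quantile {u : ℝ} (hu : u ∈ Ioo (0 : ℝ) 1) : u ≤ cdf μ (quantile μ u) :=
  (quantile_le_iff hu).1 le_rfl

lemma monotoneOn_quantile : MonotoneOn (quantile μ) (Ioo 0 1) := fun _ hu _ hv huv =>
  (quantile_le_iff hu).2 (huv.trans (le_cdf_quantile hv))

lemma tendsto_quantile_left {u : ℝ} (hu : u ∈ Ioo (0 : ℝ) 1) :
    Tendsto (quantile μ) (𝓝[<] u) (𝓝 (quantile μ u)) := by
  have hI : ∀ᶠ v in 𝓝[<] u, v ∈ Ioo (0 : ℝ) 1 ∧ v < u := by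
    filter_upwards [Ioo_mem_nhdsLT hu.1] with v hv using ⟨⟨hv.1, hv.2.trans hu.2⟩, hv.2⟩
  refine tendsto_order.2 ⟨fun y hy => ?_, fun y hy => ?_⟩
  · have h := (lt_quantile_iff hu).1 hy
    filter_upwards [hI, Ioo_mem_nhdsLT h] with v hv hv'
    exact (lt_quantile_iff hv.1).2 hv'.1
  · filter_upwards [hI] with v hv
    exact (monotoneOn_quantile hv.1 hu hv.2.le).trans_lt hy

lemma eq_dirac_of_quantile_eq {c : ℝ} (h : ∀ u ∈ Ioo (0 : ℝ) 1, quantile μ u = c) :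
    μ = Measure.dirac c := by
  refine Measure.eq_of_cdf _ _ ?_
  ext x
  by_cases hx : c ≤ x
  · have h1 : cdf μ x = 1 := by
      refine le_antisymm (cdf_le_one μ x) (le_of_forall_lt_imp_le_of_dense fun a ha => ?_)
      rcases le_or_gt a 0 with h0 | h0
      · exact h0.trans (cdf_nonneg μ x)
      · exact (quantile_le_iff ⟨h0, ha⟩).1 (by rwa [h a ⟨h0, ha⟩])
    rw [h1, cdf_eq_real, measureReal_def]
    simp [hx]
  · have h0 : cdf μ x = 0 := by
      by_contra hne
      have hpos : 0 < cdf μ x := lt_of_le_of_ne (cdf_nonneg μ x) (Ne.symm hne)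
      have hu : cdf μ x / 2 ∈ Ioo (0 : ℝ) 1 :=
        ⟨by positivity, by linarith [cdf_le_one μ x]⟩
      exact hx ((h _ hu).symm.trans_le ((quantile_le_iff hu).2 (by linarith)))
    rw [h0, cdf_eq_real, measureReal_def]
    simp [hx]

/-- A monotone left-continuous function on `(0, 1)` is the quantile function of the image of the
uniform measure. -/
lemma exists_quantile_eq {q : ℝ → ℝ} (hq : MonotoneOn q (Ioo 0 1))
    (hl : ∀ u ∈ Ioo (0 : ℝ) 1, Tendsto q (𝓝[<] u) (𝓝 (q u))) :
    ∃ σ : Measure ℝ, IsProbabilityMeasure σ ∧ ∀ u ∈ Ioo (0 : ℝ) 1, quantile σ u = q u := by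
  have hm : AEMeasurable q (volume.restrict (Ioo (0 : ℝ) 1)) :=
    aemeasurable_restrict_of_monotoneOn measurableSet_Ioo hq
  have : IsProbabilityMeasure (volume.restrict (Ioo (0 : ℝ) 1)) := ⟨by simp⟩
  refine ⟨(volume.restrict (Ioo (0 : ℝ) 1)).map q, Measure.isProbabilityMeasure_map hm, ?_⟩
  intro u hu
  have hset : {x : ℝ | u ≤ (((volume.restrict (Ioo (0 : ℝ) 1)).map q) (Iic x)).toReal}
      = Ici (q u) := by
    ext x
    rw [mem_ofPred_eq, Measure.map_apply_of_aemeasurable hm measurableSet_Iic, mem_Ici]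
    constructor
    · intro h
      by_contra! hx
      obtain ⟨v, hvx, hv0, hvu⟩ :=
        (((hl u hu).eventually (lt_mem_nhds hx)).and (Ioo_mem_nhdsLT hu.1)).exists
      have hsub : (volume.restrict (Ioo (0 : ℝ) 1)) (q ⁻¹' Iic x) ≤ ENNReal.ofReal v := by
        rw [Measure.restrict_apply' measurableSet_Ioo]
        calc volume (q ⁻¹' Iic x ∩ Ioo 0 1) ≤ volume (Ioo 0 v) := by
              refine measure_mono fun w hw => ⟨hw.2.1, ?_⟩
              by_contra! hvw
              exact absurd (hq ⟨hv0, hvu.trans hu.2⟩ hw.2 hvw) (not_le.2 (lt_of_le_of_lt hw.1 hvx))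
          _ = ENNReal.ofReal v := by simp
      have := ENNReal.toReal_mono ENNReal.ofReal_ne_top hsub
      rw [ENNReal.toReal_ofReal hv0.le] at this
      linarith
    · intro h
      have hsub : ENNReal.ofReal u ≤ (volume.restrict (Ioo (0 : ℝ) 1)) (q ⁻¹' Iic x) := by
        rw [Measure.restrict_apply' measurableSet_Ioo]
        calc ENNReal.ofReal u = volume (Ioc 0 u) := by simp
          _ ≤ _ := measure_mono fun w hw => by
            have hw' : w ∈ Ioo (0 : ℝ) 1 := ⟨hw.1, hw.2.trans_lt hu.2⟩
            exact ⟨(hq hw' hu hw.2).trans h, hw'⟩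
      have := ENNReal.toReal_mono (measure_ne_top _ _) hsub
      rwa [ENNReal.toReal_ofReal hu.1.le] at this
  rw [quantile, hset, csInf_Ici]

/-- The image of the uniform measure on `(0, 1)` under the quantile function is the measure. -/
lemma map_quantile : (volume.restrict (Ioo (0 : ℝ) 1)).map (quantile μ) = μ := by
  have hm : AEMeasurable (quantile μ) (volume.restrict (Ioo (0 : ℝ) 1)) :=
    aemeasurable_restrict_of_monotoneOn measurableSet_Ioo monotoneOn_quantile
  have : IsProbabilityMeasure (volume.restrict (Ioo (0 : ℝ) 1)) := ⟨by simp⟩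
  have := Measure.isProbabilityMeasure_map hm
  refine Measure.ext_of_Iic _ _ fun x => ?_
  rw [Measure.map_apply_of_aemeasurable hm measurableSet_Iic,
    Measure.restrict_apply' measurableSet_Ioo, ← ofReal_cdf μ x]
  have hset : quantile μ ⁻¹' Iic x ∩ Ioo 0 1 = Iic (cdf μ x) ∩ Ioo 0 1 := by
    ext u
    simp only [mem_inter_iff, mem_preimage, mem_Iic]
    exact and_congr_left fun hu => quantile_le_iff hu
  rw [hset]
  refine le_antisymm ?_ ?_
  · calc volume (Iic (cdf μ x) ∩ Ioo 0 1) ≤ volume (Ioc 0 (cdf μ x)) :=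
          measure_mono fun u hu => ⟨hu.2.1, hu.1⟩
      _ = _ := by simp
  · calc ENNReal.ofReal (cdf μ x) = volume (Ioo 0 (cdf μ x)) := by simp
      _ ≤ volume (Iic (cdf μ x) ∩ Ioo 0 1) :=
          measure_mono fun u hu => ⟨hu.2.le, hu.1, hu.2.trans_le (cdf_le_one μ x)⟩

end Quantile

/-- The integrated form of the statement that `q` has derivative `1 / I` with `I` concave. -/
def IncrementConvex (q : ℝ → ℝ) : Prop :=
  ∀ u₁ v₁ u₂ v₂ t : ℝ, 0 < u₁ → u₁ ≤ v₁ → v₁ < 1 → 0 < u₂ → u₂ ≤ v₂ → v₂ < 1 → 0 ≤ t → t ≤ 1 →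
    ((1 - t) * (v₁ - u₁) + t * (v₂ - u₂)) *
        (q ((1 - t) * v₁ + t * v₂) - q ((1 - t) * u₁ + t * u₂)) ≤
      (1 - t) * (v₁ - u₁) * (q v₁ - q u₁) + t * (v₂ - u₂) * (q v₂ - q u₂)

lemma IncrementConvex.of_eq_combination {q q₀ q₁ : ℝ → ℝ} {a b : ℝ} (ha : 0 ≤ a) (hb : 0 ≤ b)
    (h₀ : IncrementConvex q₀) (h₁ : IncrementConvex q₁)
    (hq : ∀ u ∈ Ioo (0 : ℝ) 1, q u = a * q₀ u + b * q₁ u) : IncrementConvex q := by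
  intro u₁ v₁ u₂ v₂ t hu₁ huv₁ hv₁ hu₂ huv₂ hv₂ ht₀ ht₁
  have hc : ∀ x ∈ Ioo (0 : ℝ) 1, ∀ y ∈ Ioo (0 : ℝ) 1, (1 - t) * x + t * y ∈ Ioo (0 : ℝ) 1 :=
    fun x hx y hy => convex_Ioo 0 1 hx hy (by linarith) ht₀ (by ring)
  have hu₁' : u₁ ∈ Ioo (0 : ℝ) 1 := ⟨hu₁, by linarith⟩
  have hv₁' : v₁ ∈ Ioo (0 : ℝ) 1 := ⟨by linarith, hv₁⟩
  have hu₂' : u₂ ∈ Ioo (0 : ℝ) 1 := ⟨hu₂, by linarith⟩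
  have hv₂' : v₂ ∈ Ioo (0 : ℝ) 1 := ⟨by linarith, hv₂⟩
  rw [hq _ hu₁', hq _ hv₁', hq _ hu₂', hq _ hv₂', hq _ (hc _ hu₁' _ hu₂'),
    hq _ (hc _ hv₁' _ hv₂')]
  have e₀ := mul_le_mul_of_nonneg_left
    (h₀ u₁ v₁ u₂ v₂ t hu₁ huv₁ hv₁ hu₂ huv₂ hv₂ ht₀ ht₁) ha
  have e₁ := mul_le_mul_of_nonneg_left
    (h₁ u₁ v₁ u₂ v₂ t hu₁ huv₁ hv₁ hu₂ huv₂ hv₂ ht₀ ht₁) hb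
  linear_combination e₀ + e₁

lemma IncrementConvex.sub_le {q : ℝ → ℝ} (h : IncrementConvex q) {u₁ v₁ u₂ v₂ t s : ℝ}
    (hu₁ : 0 < u₁) (huv₁ : u₁ ≤ v₁) (hv₁ : v₁ < 1) (hu₂ : 0 < u₂) (huv₂ : u₂ ≤ v₂) (hv₂ : v₂ < 1)
    (ht₀ : 0 ≤ t) (ht₁ : t ≤ 1) (hs : 0 ≤ s) (h₁ : q v₁ - q u₁ ≤ s) (h₂ : q v₂ - q u₂ ≤ s) :
    q ((1 - t) * v₁ + t * v₂) - q ((1 - t) * u₁ + t * u₂) ≤ s := by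
  have a₁ : 0 ≤ (1 - t) * (v₁ - u₁) := mul_nonneg (by linarith) (by linarith)
  have a₂ : 0 ≤ t * (v₂ - u₂) := mul_nonneg ht₀ (by linarith)
  rcases (add_nonneg a₁ a₂).eq_or_lt with h0 | h0
  · have : (1 - t) * v₁ + t * v₂ = (1 - t) * u₁ + t * u₂ := by linarith
    rw [this, sub_self]
    exact hs
  · refine le_of_mul_le_mul_left ?_ h0
    have := h u₁ v₁ u₂ v₂ t hu₁ huv₁ hv₁ hu₂ huv₂ hv₂ ht₀ ht₁
    nlinarith [mul_le_mul_of_nonneg_left h₁ a₁, mul_le_mul_of_nonneg_left h₂ a₂]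

section Density

variable {μ : Measure ℝ} [IsProbabilityMeasure μ]

lemma IncrementConvex.concaveOn_cdf_quantile_add (h : IncrementConvex (quantile μ)) {s : ℝ}
    (hs : 0 ≤ s) : ConcaveOn ℝ (Ioo 0 1) fun u => cdf μ (quantile μ u + s) := by
  refine ⟨convex_Ioo 0 1, fun u₁ hu₁ u₂ hu₂ a t ha ht hat => ?_⟩
  obtain rfl : a = 1 - t := by linarith
  have hc := convex_Ioo 0 1 hu₁ hu₂ ha ht hat
  simp only [smul_eq_mul] at hc ⊢
  set v₁ := cdf μ (quantile μ u₁ + s) with hv₁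
  set v₂ := cdf μ (quantile μ u₂ + s) with hv₂
  have hle : ∀ u ∈ Ioo (0 : ℝ) 1, u ≤ cdf μ (quantile μ u + s) := fun u hu =>
    (le_cdf_quantile hu).trans (monotone_cdf μ (by linarith))
  have h₁ := hle u₁ hu₁
  have h₂ := hle u₂ hu₂
  have h₁' : v₁ ≤ 1 := cdf_le_one μ _
  have h₂' : v₂ ≤ 1 := cdf_le_one μ _
  by_contra! hlt
  set d := (1 - t) * v₁ + t * v₂ - cdf μ (quantile μ ((1 - t) * u₁ + t * u₂) + s) with hd
  have hd0 : 0 < d := by linarith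
  have hd1 : d ≤ 1 := by
    have := cdf_nonneg μ (quantile μ ((1 - t) * u₁ + t * u₂) + s)
    nlinarith
  have key : ∀ u ∈ Ioo (0 : ℝ) 1, ∀ v, u ≤ v → v ≤ 1 → v = cdf μ (quantile μ u + s) →
      u ≤ u + (1 - d / 2) * (v - u) ∧ u + (1 - d / 2) * (v - u) < 1 ∧
        quantile μ (u + (1 - d / 2) * (v - u)) - quantile μ u ≤ s := by
    intro u hu v huv hv1 hv
    have e1 : u ≤ u + (1 - d / 2) * (v - u) := by nlinarith
    have e2 : u + (1 - d / 2) * (v - u) < 1 := by nlinarith [hu.2]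
    refine ⟨e1, e2, ?_⟩
    have : quantile μ (u + (1 - d / 2) * (v - u)) ≤ quantile μ u + s := by
      rw [quantile_le_iff ⟨hu.1.trans_le e1, e2⟩, ← hv]
      nlinarith
    linarith
  obtain ⟨a₁, a₂, a₃⟩ := key u₁ hu₁ v₁ h₁ h₁' hv₁
  obtain ⟨b₁, b₂, b₃⟩ := key u₂ hu₂ v₂ h₂ h₂' hv₂
  have hq := h.sub_le hu₁.1 a₁ a₂ hu₂.1 b₁ b₂ ht (by linarith) hs a₃ b₃
  have hw : (1 - t) * (u₁ + (1 - d / 2) * (v₁ - u₁)) + t * (u₂ + (1 - d / 2) * (v₂ - u₂))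
      ∈ Ioo (0 : ℝ) 1 :=
    convex_Ioo 0 1 ⟨hu₁.1.trans_le a₁, a₂⟩ ⟨hu₂.1.trans_le b₁, b₂⟩ ha ht hat
  have hq' := (quantile_le_iff hw).1 (sub_le_iff_le_add'.1 hq)
  have hB : (1 - t) * (v₁ - u₁) + t * (v₂ - u₂) ≤ 1 := by
    nlinarith [hu₁.1, hu₂.1]
  nlinarith

lemma ConcaveOn.mul_le_of_nonneg {φ : ℝ → ℝ} (hφ : ConcaveOn ℝ (Ioo 0 1) φ)
    (h0 : ∀ u ∈ Ioo (0 : ℝ) 1, 0 ≤ φ u) {α β u v : ℝ} (hα : 0 < α) (hβ : β < 1)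
    (hu : u ∈ Ioo (0 : ℝ) 1) (hv : v ∈ Icc α β) : min α (1 - β) / 2 * φ u ≤ φ v := by
  have hmα := min_le_left α (1 - β)
  have hmβ := min_le_right α (1 - β)
  have hm : 0 < min α (1 - β) := lt_min hα (by linarith)
  set m := min α (1 - β)
  have main : ∀ w ∈ Ioo (0 : ℝ) 1, ∀ a b : ℝ, m / 2 ≤ a → 0 ≤ b → a + b = 1 →
      a * u + b * w = v → m / 2 * φ u ≤ φ v := by
    intro w hw a b ha hb hab he
    have := hφ.2 hu hw (by linarith) hb hab
    simp only [smul_eq_mul] at this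
    rw [he] at this
    nlinarith [h0 u hu, h0 w hw, mul_nonneg hb (h0 w hw)]
  rcases lt_trichotomy u v with huv | huv | huv
  · obtain ⟨w, hw⟩ : ∃ w, w = (1 + β) / 2 := ⟨_, rfl⟩
    have hw1 : 0 < w - u := by linarith [hv.2]
    have hw2 := hw1.ne'
    refine main w ⟨by linarith [hv.1, hv.2], by linarith⟩
      ((w - v) / (w - u)) ((v - u) / (w - u)) ?_ ?_ ?_ ?_
    · rw [le_div_iff₀ hw1]
      nlinarith [hv.2, hu.1]
    · exact div_nonneg (by linarith) hw1.le
    · field_simp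
      ring
    · field_simp
      ring
  · refine main u hu 1 0 ?_ le_rfl (by norm_num) (by linarith)
    linarith [hv.1, hv.2]
  · obtain ⟨w, hw⟩ : ∃ w, w = α / 2 := ⟨_, rfl⟩
    have hw1 : 0 < u - w := by linarith [hv.1]
    have hw2 := hw1.ne'
    refine main w ⟨by linarith, by linarith [hv.1, hv.2]⟩
      ((v - w) / (u - w)) ((u - v) / (u - w)) ?_ ?_ ?_ ?_
    · rw [le_div_iff₀ hw1]
      nlinarith [hv.1, hu.2]
    · exact div_nonneg (by linarith) hw1.le
    · field_simp
      ring
    · field_simp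
      ring

lemma exists_cdf_quantile_add_sub_le {α β s : ℝ} (hα : α ∈ Ioo (0 : ℝ) 1) (hβ : β ∈ Ioo (0 : ℝ) 1)
    (hαβ : quantile μ α < quantile μ β) (hs : 0 < s) :
    ∃ v ∈ Icc α β, cdf μ (quantile μ v + s) - v ≤ s / (quantile μ β - quantile μ α) := by
  set l := quantile μ β - quantile μ α
  have hl : 0 < l := sub_pos.2 hαβ
  set K := ⌈l / s⌉₊
  have hK : 0 < K := Nat.ceil_pos.2 (div_pos hl hs)
  have hK' : (0 : ℝ) < K := by exact_mod_cast hK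
  set x : ℕ → ℝ := fun k => quantile μ α + k * s
  have hsum : ∑ k ∈ Finset.range K, (cdf μ (x (k + 1)) - cdf μ (x k)) ≤
      ∑ k ∈ Finset.range K, (1 / K : ℝ) := by
    rw [Finset.sum_range_sub (fun k => cdf μ (x k)), Finset.sum_const, Finset.card_range,
      nsmul_eq_mul, mul_one_div_cancel hK'.ne']
    linarith [cdf_le_one μ (x K), cdf_nonneg μ (x 0)]
  obtain ⟨k, hk, hle⟩ := Finset.exists_le_of_sum_le ⟨0, Finset.mem_range.2 hK⟩ hsum
  have hkl : k * s < l := (lt_div_iff₀ hs).1 (Nat.lt_ceil.1 (Finset.mem_range.1 hk))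
  have hv1 : α ≤ cdf μ (x k) :=
    (quantile_le_iff hα).1 (by simp only [x]; nlinarith [k.cast_nonneg (α := ℝ)])
  have hv2 : cdf μ (x k) < β := (lt_quantile_iff hβ).1 (by simp only [x]; linarith)
  refine ⟨cdf μ (x k), ⟨hv1, hv2.le⟩, ?_⟩
  have hq : quantile μ (cdf μ (x k)) ≤ x k :=
    (quantile_le_iff ⟨hα.1.trans_le hv1, hv2.trans hβ.2⟩).2 le_rfl
  have hx : cdf μ (quantile μ (cdf μ (x k)) + s) ≤ cdf μ (x (k + 1)) :=
    monotone_cdf μ (by simp only [x] at hq ⊢; push_cast; linarith)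
  have h1 : (1 / K : ℝ) ≤ s / l := by
    rw [div_le_div_iff₀ hK' hl, one_mul, mul_comm]
    exact (div_le_iff₀ hs).1 (Nat.le_ceil _)
  linarith

lemma IncrementConvex.exists_lipschitzWith_cdf (h : IncrementConvex (quantile μ)) {α β : ℝ}
    (hα : α ∈ Ioo (0 : ℝ) 1) (hβ : β ∈ Ioo (0 : ℝ) 1) (hαβ : quantile μ α < quantile μ β) :
    ∃ C, LipschitzWith C (cdf μ) := by
  set l := quantile μ β - quantile μ α with hl_def
  have hl : 0 < l := sub_pos.2 hαβ
  set m := min α (1 - β) / 2 with hm_def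
  have hm : 0 < m := half_pos (lt_min hα.1 (by linarith [hβ.2]))
  have hC : 0 < 1 / (m * l) := by positivity
  have hφ : ∀ s > 0, ∀ u ∈ Ioo (0 : ℝ) 1,
      cdf μ (quantile μ u + s) - u ≤ 1 / (m * l) * s := by
    intro s hs u hu
    obtain ⟨v, hv, hvs⟩ := exists_cdf_quantile_add_sub_le hα hβ hαβ hs
    have hconc := (h.concaveOn_cdf_quantile_add hs.le).sub (convexOn_id (convex_Ioo 0 1))
    have := hconc.mul_le_of_nonneg
      (fun u hu => sub_nonneg.2 ((le_cdf_quantile hu).trans (monotone_cdf μ (by linarith))))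
      hα.1 hβ.2 hu hv
    have h2 : m * (cdf μ (quantile μ u + s) - u) ≤ s / l := this.trans hvs
    calc cdf μ (quantile μ u + s) - u ≤ (s / l) / m := by rwa [le_div_iff₀ hm, mul_comm]
      _ = _ := by field_simp
  have hadd : ∀ x, ∀ s > 0, cdf μ (x + s) ≤ cdf μ x + 1 / (m * l) * s := by
    intro x s hs
    rcases (cdf_le_one μ x).eq_or_lt with h1 | h1
    · rw [h1]
      linarith [cdf_le_one μ (x + s), mul_pos hC hs]
    · rw [← sub_le_iff_le_add]
      refine le_of_forall_gt_imp_ge_of_dense fun u hu => ?_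
      rcases le_or_gt 1 u with hu1 | hu1
      · linarith [cdf_le_one μ (x + s), mul_pos hC hs]
      · have hu' : u ∈ Ioo (0 : ℝ) 1 := ⟨(cdf_nonneg μ x).trans_lt hu, hu1⟩
        have := (lt_quantile_iff hu').2 hu
        have := monotone_cdf μ (show x + s ≤ quantile μ u + s by linarith)
        linarith [hφ s hs u hu']
  refine ⟨⟨1 / (m * l), hC.le⟩, LipschitzWith.of_le_add_mul _ fun x y => ?_⟩
  change cdf μ x ≤ cdf μ y + 1 / (m * l) * dist x y
  rcases le_or_gt x y with hxy | hxy
  · have := monotone_cdf μ hxy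
    have := mul_nonneg hC.le (dist_nonneg (x := x) (y := y))
    linarith
  · have := hadd y (x - y) (by linarith)
    rwa [add_sub_cancel, ← abs_of_pos (sub_pos.2 hxy), ← Real.dist_eq] at this

lemma IncrementConvex.cdf_add_eq (h : IncrementConvex (quantile μ)) {x s : ℝ} (hs : 0 ≤ s)
    (hx : cdf μ x ∈ Ioo (0 : ℝ) 1) : cdf μ (x + s) = cdf μ (quantile μ (cdf μ x) + s) := by
  refine le_antisymm ?_ (monotone_cdf μ ?_)
  · have hc : Tendsto (fun u => cdf μ (quantile μ u + s)) (𝓝[>] (cdf μ x)) (𝓝 _) :=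
      (((h.concaveOn_cdf_quantile_add hs).continuousOn isOpen_Ioo).continuousAt
        (isOpen_Ioo.mem_nhds hx)).tendsto.mono_left nhdsWithin_le_nhds
    refine ge_of_tendsto hc ?_
    filter_upwards [Ioo_mem_nhdsGT hx.2] with u hu
    have := (lt_quantile_iff ⟨hx.1.trans hu.1, hu.2⟩).2 hu.1
    exact monotone_cdf μ (by linarith)
  · have := (quantile_le_iff (μ := μ) hx).2 le_rfl
    linarith

lemma ConcaveOn.increment_mul_le {R : ℝ → ℝ} {S : Set ℝ} (hR : ConcaveOn ℝ S R)
    {u₀ u₁ : ℝ} (hu₀ : u₀ ∈ S) (hu₁ : u₁ ∈ S) (hw₀ : R u₀ ∈ S) (hw₁ : R u₁ ∈ S)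
    (h₀ : u₀ ≤ R u₀) (h₁ : u₁ ≤ R u₁) (hu : u₀ ≤ u₁) (hw : R u₀ ≤ R u₁) :
    (u₁ - u₀) * (R (R u₁) - R (R u₀)) ≤ (R u₁ - R u₀) ^ 2 := by
  rcases hu.eq_or_lt with hu | hu
  · simp [hu]
  rcases hw.eq_or_lt with hw | hw
  · simp [hw]
  have e1 := (hR.neg).secant_mono hu₀ hu₁ hw₁ hu.ne' (by linarith) h₁
  have e2 := (hR.neg).secant_mono hw₁ hu₀ hw₀ (by linarith) hw.ne h₀
  simp only [Pi.neg_apply] at e1 e2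
  have e3 : (R (R u₁) - R (R u₀)) / (R u₁ - R u₀) ≤ (R u₁ - R u₀) / (u₁ - u₀) := by
    rw [← neg_div_neg_eq (-R u₀ - -R (R u₁)), ← neg_div_neg_eq (-R (R u₀) - -R (R u₁))] at e2
    have f1 : -(-R u₀ - -R (R u₁)) = -R (R u₁) - -R u₀ := by ring
    have f2 : -(u₀ - R u₁) = R u₁ - u₀ := by ring
    have f3 : -(-R (R u₀) - -R (R u₁)) = - (R (R u₁) - R (R u₀)) := by ring
    have f4 : -(R u₀ - R u₁) = R u₁ - R u₀ := by ring
    have f5 : - R u₁ - - R u₀ = - (R u₁ - R u₀) := by ring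
    rw [f1, f2, f3, f4] at e2
    rw [f5] at e1
    have := e1.trans e2
    rw [neg_div, neg_div] at this
    linarith
  rw [div_le_div_iff₀ (by linarith) (by linarith)] at e3
  linarith

lemma IncrementConvex.increment_mul_le (h : IncrementConvex (quantile μ)) {x s δ : ℝ} (hs : 0 ≤ s)
    (hδ : 0 ≤ δ) (hx : 0 < cdf μ x) (hx' : cdf μ (x + 2 * s + δ) < 1) :
    (cdf μ (x + δ) - cdf μ x) * (cdf μ (x + 2 * s + δ) - cdf μ (x + 2 * s)) ≤
      (cdf μ (x + s + δ) - cdf μ (x + s)) ^ 2 := by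
  have hmem : ∀ y, x ≤ y → y ≤ x + 2 * s + δ → cdf μ y ∈ Ioo (0 : ℝ) 1 := fun y h1 h2 =>
    ⟨hx.trans_le (monotone_cdf μ h1), (monotone_cdf μ h2).trans_lt hx'⟩
  have hadd : ∀ y, x ≤ y → y + s ≤ x + 2 * s + δ →
      cdf μ (y + s) = cdf μ (quantile μ (cdf μ y) + s) := fun y h1 h2 =>
    h.cdf_add_eq hs (hmem y h1 (by linarith))
  have k := (h.concaveOn_cdf_quantile_add hs).increment_mul_le
    (u₀ := cdf μ x) (u₁ := cdf μ (x + δ))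
  have r₀ := hadd x le_rfl (by linarith)
  have r₁ := hadd (x + δ) (by linarith) (by linarith)
  have r₂ := hadd (x + s) (by linarith) (by linarith)
  have r₃ := hadd (x + δ + s) (by linarith) (by linarith)
  simp only [← r₀, ← r₁, ← r₂, ← r₃] at k
  rw [show x + 2 * s + δ = x + δ + s + s by ring, show x + 2 * s = x + s + s by ring,
    show x + s + δ = x + δ + s by ring]
  exact k (hmem _ le_rfl (by linarith)) (hmem _ (by linarith) (by linarith))
    (hmem _ (by linarith) (by linarith)) (hmem _ (by linarith) (by linarith))
    (monotone_cdf μ (by linarith)) (monotone_cdf μ (by linarith))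
    (monotone_cdf μ (by linarith)) (monotone_cdf μ (by linarith))

lemma Icc_subset_of_isClosed_of_midpoint {S : Set ℝ} (hS : IsClosed S) (h0 : (0 : ℝ) ∈ S)
    (h1 : (1 : ℝ) ∈ S) (hmid : ∀ a ∈ S, ∀ b ∈ S, (a + b) / 2 ∈ S) : Icc 0 1 ⊆ S := by
  intro t ht
  by_contra hts
  have hA : sSup (S ∩ Iic t) ∈ S ∩ Iic t :=
    (hS.inter isClosed_Iic).csSup_mem ⟨0, h0, ht.1⟩ (bddAbove_Iic.mono inter_subset_right)
  have hB : sInf (S ∩ Ici t) ∈ S ∩ Ici t :=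
    (hS.inter isClosed_Ici).csInf_mem ⟨1, h1, ht.2⟩ (bddBelow_Ici.mono inter_subset_right)
  set a := sSup (S ∩ Iic t)
  set b := sInf (S ∩ Ici t)
  have hat : a < t := lt_of_le_of_ne hA.2 fun h => hts (h ▸ hA.1)
  have htb : t < b := lt_of_le_of_ne hB.2 fun h => hts (h ▸ hB.1)
  have hm := hmid a hA.1 b hB.1
  rcases le_total ((a + b) / 2) t with h | h
  · have : (a + b) / 2 ≤ a := le_csSup (bddAbove_Iic.mono inter_subset_right) ⟨hm, h⟩
    linarith
  · have : b ≤ (a + b) / 2 := csInf_le (bddBelow_Ici.mono inter_subset_right) ⟨hm, h⟩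
    linarith

lemma rpow_mul_rpow_le_of_midpoint {G : ℝ → ℝ} (hG : Continuous G) (hG0 : ∀ x, 0 ≤ G x) {x y : ℝ}
    (hxy : x ≤ y) (hx : 0 < G x) (hy : 0 < G y)
    (hmid : ∀ a ∈ Icc x y, ∀ b ∈ Icc x y, a ≤ b → G a * G b ≤ G ((a + b) / 2) ^ 2) {t : ℝ}
    (ht : t ∈ Icc (0 : ℝ) 1) : G x ^ (1 - t) * G y ^ t ≤ G ((1 - t) * x + t * y) := by
  have hmid' : ∀ a ∈ Icc x y, ∀ b ∈ Icc x y, G a * G b ≤ G ((a + b) / 2) ^ 2 := by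
    intro a ha b hb
    rcases le_total a b with h | h
    · exact hmid a ha b hb h
    · rw [mul_comm, add_comm]
      exact hmid b hb a ha h
  have hL : Continuous fun t : ℝ => G x ^ (1 - t) * G y ^ t :=
    (continuous_const.rpow (by fun_prop) fun _ => Or.inl hx.ne').mul
      (continuous_const.rpow continuous_id fun _ => Or.inl hy.ne')
  have hR : Continuous fun t : ℝ => G ((1 - t) * x + t * y) := hG.comp (by fun_prop)
  have hS : IsClosed ({t : ℝ | G x ^ (1 - t) * G y ^ t ≤ G ((1 - t) * x + t * y)} ∩ Icc 0 1) :=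
    (isClosed_le hL hR).inter isClosed_Icc
  refine (Icc_subset_of_isClosed_of_midpoint hS ⟨by simp, by simp⟩ ⟨by simp, by simp⟩ ?_ ht).1
  rintro a ⟨ha, ha01⟩ b ⟨hb, hb01⟩
  refine ⟨?_, by constructor <;> linarith [ha01.1, ha01.2, hb01.1, hb01.2]⟩
  have hz : ∀ s ∈ Icc (0 : ℝ) 1, (1 - s) * x + s * y ∈ Icc x y := fun s hs =>
    convex_Icc x y (left_mem_Icc.2 hxy) (right_mem_Icc.2 hxy) (by linarith [hs.2]) hs.1 (by ring)
  have hm := hmid' _ (hz a ha01) _ (hz b hb01)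
  have hc : ((1 - a) * x + a * y + ((1 - b) * x + b * y)) / 2
      = (1 - (a + b) / 2) * x + (a + b) / 2 * y := by ring
  rw [hc] at hm
  simp only [mem_ofPred_eq] at ha hb ⊢
  refine (pow_le_pow_iff_left₀ (by positivity) (hG0 _) two_ne_zero).1 ?_
  refine le_trans (le_of_eq ?_) ((mul_le_mul ha hb (by positivity) (hG0 _)).trans hm)
  rw [mul_pow, ← Real.rpow_mul_natCast hx.le, ← Real.rpow_mul_natCast hy.le, mul_mul_mul_comm,
    ← Real.rpow_add hx, ← Real.rpow_add hy]
  congr 2 <;> push_cast <;> ring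

lemma absolutelyContinuous_of_lipschitzWith_cdf {C : NNReal} (hC : LipschitzWith C (cdf μ)) :
    μ ≪ volume := by
  let G : StieltjesFunction ℝ :=
    { toFun := fun x => C * x - cdf μ x
      mono' := fun x y hxy => by
        have := hC.le_add_mul y x
        rw [Real.dist_eq, abs_of_nonneg (sub_nonneg.2 hxy)] at this
        dsimp only
        linarith
      right_continuous' := fun x =>
        ((continuous_const.mul continuous_id).sub hC.continuous).continuousWithinAt }
  have hsum : cdf μ + G = C • StieltjesFunction.id := by
    ext x
    change cdf μ x + (C * x - cdf μ x) = C * x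
    ring
  have hμ : μ + G.measure = C • volume := by
    rw [Real.volume_eq_stieltjes_id, ← StieltjesFunction.measure_smul, ← hsum,
      StieltjesFunction.measure_add, measure_cdf]
  have hle : μ ≤ C • volume := hμ ▸ Measure.le_add_right le_rfl
  exact hle.absolutelyContinuous.trans Measure.smul_absolutelyContinuous

lemma HasDerivAt.cdf_eq_zero {ν : Measure ℝ} {d x : ℝ} (hd : HasDerivAt (cdf ν) d x)
    (hx : cdf ν x ∉ Ioo (0 : ℝ) 1) : d = 0 := by
  rcases (cdf_nonneg ν x).eq_or_lt with h0 | h0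
  · exact IsLocalMin.hasDerivAt_eq_zero (.of_forall fun y => h0 ▸ cdf_nonneg ν y) hd
  · have h1 : cdf ν x = 1 :=
      le_antisymm (cdf_le_one ν x) (not_lt.1 fun h => hx ⟨h0, h⟩)
    exact IsLocalMax.hasDerivAt_eq_zero (.of_forall fun y => h1 ▸ cdf_le_one ν y) hd

lemma IncrementConvex.increment_rpow_mul_le (h : IncrementConvex (quantile μ))
    (hcont : Continuous (cdf μ)) {x y δ t : ℝ} (hδ : 0 ≤ δ) (hxy : x ≤ y) (hx : 0 < cdf μ x)
    (hy : cdf μ (y + δ) < 1) (ht : t ∈ Ioo (0 : ℝ) 1) :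
    (cdf μ (x + δ) - cdf μ x) ^ (1 - t) * (cdf μ (y + δ) - cdf μ y) ^ t ≤
      cdf μ ((1 - t) * x + t * y + δ) - cdf μ ((1 - t) * x + t * y) := by
  have hG0 : ∀ z, 0 ≤ cdf μ (z + δ) - cdf μ z := fun z =>
    sub_nonneg.2 (monotone_cdf μ (by linarith))
  rcases (hG0 x).eq_or_lt with h0 | h0
  · rw [← h0, Real.zero_rpow (by linarith [ht.2]), zero_mul]
    exact hG0 _
  rcases (hG0 y).eq_or_lt with h1 | h1
  · rw [← h1, Real.zero_rpow ht.1.ne', mul_zero]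
    exact hG0 _
  refine rpow_mul_rpow_le_of_midpoint (G := fun z => cdf μ (z + δ) - cdf μ z)
    ((hcont.comp (by fun_prop)).sub hcont) hG0 hxy h0 h1 (fun a ha b hb hab => ?_)
    (Ioo_subset_Icc_self ht)
  have := h.increment_mul_le (x := a) (s := (b - a) / 2) (by linarith) hδ
    (hx.trans_le (monotone_cdf μ ha.1))
    ((monotone_cdf μ (by linarith [hb.2])).trans_lt hy)
  rwa [show a + 2 * ((b - a) / 2) = b by ring, show a + (b - a) / 2 = (a + b) / 2 by ring] at this

lemma mul_rpow_mul_rpow {a b c t : ℝ} (hc : 0 < c) (ha : 0 ≤ a) (hb : 0 ≤ b) :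
    (c * a) ^ (1 - t) * (c * b) ^ t = c * (a ^ (1 - t) * b ^ t) := by
  rw [Real.mul_rpow hc.le ha, Real.mul_rpow hc.le hb, mul_mul_mul_comm, ← Real.rpow_add hc,
    sub_add_cancel, Real.rpow_one]

theorem IncrementConvex.isLogConcave (h : IncrementConvex (quantile μ)) : IsLogConcave μ := by
  by_cases hc : ∃ α ∈ Ioo (0 : ℝ) 1, ∃ β ∈ Ioo (0 : ℝ) 1, quantile μ α < quantile μ β
  swap
  · push Not at hc
    refine Or.inl ⟨quantile μ (1 / 2), eq_dirac_of_quantile_eq fun u hu => ?_⟩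
    exact le_antisymm (hc _ (by norm_num) u hu) (hc u hu _ (by norm_num))
  obtain ⟨α, hα, β, hβ, hαβ⟩ := hc
  obtain ⟨C, hC⟩ := h.exists_lipschitzWith_cdf hα hβ hαβ
  have hcont := hC.continuous
  have hac := absolutelyContinuous_of_lipschitzWith_cdf hC
  let δ : ℕ → ℝ := fun n => 1 / ((n : ℝ) + 1)
  have hδ : ∀ n, 0 < δ n := fun n => by positivity
  have hδ0 : Tendsto δ atTop (𝓝 0) := tendsto_one_div_add_atTop_nhds_zero_nat
  let N : ℕ → ℝ → ℝ := fun n x => (δ n)⁻¹ * (cdf μ (x + δ n) - cdf μ x)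
  have hN : ∀ n x, N n x ∈ Icc (0 : ℝ) C := by
    intro n x
    have h1 := monotone_cdf μ (show x ≤ x + δ n by linarith [hδ n])
    have h2 := hC.le_add_mul (x + δ n) x
    rw [Real.dist_eq, add_sub_cancel_left, abs_of_pos (hδ n)] at h2
    exact ⟨mul_nonneg (inv_nonneg.2 (hδ n).le) (by linarith), by
      rw [inv_mul_le_iff₀ (hδ n)]; linarith⟩
  have hlim : ∀ x, ∃ l ∈ Icc (0 : ℝ) C,
      Tendsto (fun n : ℕ => N n x) (hyperfilter ℕ : Filter ℕ) (𝓝 l) := by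
    intro x
    exact isCompact_Icc.ultrafilter_le_nhds ((hyperfilter ℕ).map (fun n : ℕ => N n x))
      (le_principal_iff.2 (show ∀ᶠ n in (hyperfilter ℕ : Filter ℕ), N n x ∈ Icc (0 : ℝ) C from
        .of_forall fun n => hN n x))
  choose g hgC hg using hlim
  classical
  let f : ℝ → ℝ := fun x => if cdf μ x ∈ Ioo (0 : ℝ) 1 then g x else 0
  have hf0 : ∀ x, 0 ≤ f x := by
    intro x
    by_cases hx : cdf μ x ∈ Ioo (0 : ℝ) 1
    · simpa only [f, if_pos hx] using (hgC x).1
    · simp only [f, if_neg hx, le_refl]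
  have hderiv : ∀ x d, HasDerivAt (cdf μ) d x → f x = d := by
    intro x d hd
    by_cases hx : cdf μ x ∈ Ioo (0 : ℝ) 1
    · simp only [f, if_pos hx]
      refine tendsto_nhds_unique (hg x) ?_
      have h1 : Tendsto δ (hyperfilter ℕ : Filter ℕ) (𝓝[≠] 0) :=
        tendsto_nhdsWithin_iff.2 ⟨hδ0.mono_left Nat.hyperfilter_le_atTop,
          .of_forall fun n => (hδ n).ne'⟩
      exact (hasDerivAt_iff_tendsto_slope_zero.1 hd).comp h1
    · simp only [f, if_neg hx]
      exact (hd.cdf_eq_zero hx).symm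
  have hmono : ∀ x y : ℝ, x ≤ y → ∀ t ∈ Icc (0 : ℝ) 1,
      f x ^ (1 - t) * f y ^ t ≤ f ((1 - t) * x + t * y) := by
    intro x y hxy t ht
    rcases ht.1.eq_or_lt with rfl | ht0
    · simp
    rcases ht.2.eq_or_lt with rfl | ht1
    · simp
    by_cases hx : cdf μ x ∈ Ioo (0 : ℝ) 1
    swap
    · simp only [f, if_neg hx]
      rw [Real.zero_rpow (by linarith), zero_mul]
      exact hf0 _
    by_cases hy : cdf μ y ∈ Ioo (0 : ℝ) 1
    swap
    · simp only [f, if_neg hy]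
      rw [Real.zero_rpow ht0.ne', mul_zero]
      exact hf0 _
    have hzI := convex_Icc x y (left_mem_Icc.2 hxy) (right_mem_Icc.2 hxy)
      (by linarith) ht0.le (show 1 - t + t = 1 by ring)
    simp only [smul_eq_mul] at hzI
    set z := (1 - t) * x + t * y
    have hz : cdf μ z ∈ Ioo (0 : ℝ) 1 :=
      ⟨hx.1.trans_le (monotone_cdf μ hzI.1), (monotone_cdf μ hzI.2).trans_lt hy.2⟩
    simp only [f, if_pos hx, if_pos hy, if_pos hz]
    refine le_of_tendsto_of_tendsto (((hg x).rpow_const (Or.inr (by linarith))).mul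
      ((hg y).rpow_const (Or.inr ht0.le))) (hg z) ?_
    have hy1 : ∀ᶠ n in (hyperfilter ℕ : Filter ℕ), cdf μ (y + δ n) < 1 := by
      have : Tendsto (fun n => cdf μ (y + δ n)) atTop (𝓝 (cdf μ (y + 0))) :=
        (hcont.tendsto _).comp (tendsto_const_nhds.add hδ0)
      rw [add_zero] at this
      exact (this.eventually (gt_mem_nhds hy.2)).filter_mono Nat.hyperfilter_le_atTop
    filter_upwards [hy1] with n hn
    have hpos : ∀ w, 0 ≤ cdf μ (w + δ n) - cdf μ w := fun w =>
      sub_nonneg.2 (monotone_cdf μ (by linarith [hδ n]))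
    simp only [N]
    rw [mul_rpow_mul_rpow (inv_pos.2 (hδ n)) (hpos x) (hpos y)]
    exact mul_le_mul_of_nonneg_left
      (h.increment_rpow_mul_le hcont (hδ n).le hxy hx.1 hn ⟨ht0, ht1⟩) (inv_nonneg.2 (hδ n).le)
  refine Or.inr ⟨f, hf0, ?_, fun x y t ht => ?_⟩
  · rw [← Measure.withDensity_rnDeriv_eq μ volume hac]
    refine withDensity_congr_ae ?_
    have hd := (cdf μ).ae_hasDerivAt
    rw [measure_cdf] at hd
    filter_upwards [hd, Measure.rnDeriv_lt_top μ volume] with x hx hx'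
    rw [hderiv x _ hx, ENNReal.ofReal_toReal hx'.ne]
  · rcases le_total x y with hxy | hxy
    · exact hmono x y hxy t ht
    · have := hmono y x hxy (1 - t) ⟨by linarith [ht.2], by linarith [ht.1]⟩
      rwa [sub_sub_cancel, mul_comm, add_comm (t * y)] at this

end Density

section LogConcaveDensity

/-- `q` has derivative `1 / I` on `(0, 1)` for some positive concave `I`. -/
def HasConcaveProfile (q : ℝ → ℝ) : Prop :=
  ∃ I : ℝ → ℝ, ConcaveOn ℝ (Ioo 0 1) I ∧ (∀ u ∈ Ioo (0 : ℝ) 1, 0 < I u) ∧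
    ∀ u ∈ Ioo (0 : ℝ) 1, HasDerivAt q (I u)⁻¹ u

variable {f : ℝ → ℝ}

lemma mul_add_le_add_mul_of_logConcave (hf0 : ∀ x, 0 ≤ f x)
    (hf : ∀ x y : ℝ, ∀ t ∈ Icc (0 : ℝ) 1, f x ^ (1 - t) * f y ^ t ≤ f ((1 - t) * x + t * y))
    {x y s : ℝ} (hxy : x ≤ y) (hs : 0 < s) : f (y + s) * f x ≤ f (x + s) * f y := by
  have hpos : 0 < y + s - x := by linarith
  have hne := hpos.ne'
  set t := s / (y + s - x) with ht_def
  have ht : t ∈ Icc (0 : ℝ) 1 := ⟨by positivity, (div_le_one hpos).2 (by linarith)⟩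
  have e1 : (1 - t) * x + t * (y + s) = x + s := by
    rw [ht_def]; field_simp; ring
  have e2 : (1 - t) * (y + s) + t * x = y := by
    rw [ht_def]; field_simp; ring
  have h1 := hf x (y + s) t ht
  have h2 := hf (y + s) x t ht
  rw [e1] at h1
  rw [e2] at h2
  have hone : ∀ z, f z ^ (1 - t) * f z ^ t = f z := fun z => by
    rw [← Real.rpow_add_of_nonneg (hf0 z) (by linarith [ht.2]) ht.1, sub_add_cancel, Real.rpow_one]
  calc f (y + s) * f x
      = (f (y + s) ^ (1 - t) * f (y + s) ^ t) * (f x ^ (1 - t) * f x ^ t) := by rw [hone, hone]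
    _ = (f x ^ (1 - t) * f (y + s) ^ t) * (f (y + s) ^ (1 - t) * f x ^ t) := by ring
    _ ≤ f (x + s) * f y := mul_le_mul h1 h2
        (mul_nonneg (Real.rpow_nonneg (hf0 _) _) (Real.rpow_nonneg (hf0 _) _)) (hf0 _)

lemma convex_support_of_logConcave
    (hf : ∀ x y : ℝ, ∀ t ∈ Icc (0 : ℝ) 1, f x ^ (1 - t) * f y ^ t ≤ f ((1 - t) * x + t * y)) :
    Convex ℝ {x | 0 < f x} := by
  intro x hx y hy a t ha ht hat
  obtain rfl : a = 1 - t := by linarith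
  have := hf x y t ⟨ht, by linarith⟩
  exact lt_of_lt_of_le (mul_pos (Real.rpow_pos_of_pos hx _) (Real.rpow_pos_of_pos hy _)) this

lemma continuousOn_of_logConcave
    (hf : ∀ x y : ℝ, ∀ t ∈ Icc (0 : ℝ) 1, f x ^ (1 - t) * f y ^ t ≤ f ((1 - t) * x + t * y)) :
    ContinuousOn f (interior {x | 0 < f x}) := by
  have hc : ConcaveOn ℝ {x | 0 < f x} fun x => Real.log (f x) := by
    refine ⟨convex_support_of_logConcave hf, fun x hx y hy a t ha ht hat => ?_⟩
    obtain rfl : a = 1 - t := by linarith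
    have h1 := hf x y t ⟨ht, by linarith⟩
    have h2 := Real.rpow_pos_of_pos hx (1 - t)
    have h3 := Real.rpow_pos_of_pos hy t
    have := Real.log_le_log (mul_pos h2 h3) h1
    rwa [Real.log_mul h2.ne' h3.ne', Real.log_rpow hx, Real.log_rpow hy] at this
  refine (Real.continuous_exp.comp_continuousOn hc.continuousOn_interior).congr fun x hx => ?_
  exact (Real.exp_log (interior_subset (s := {x | 0 < f x}) hx)).symm

lemma withDensity_compl_interior_support (hS : Convex ℝ {x | 0 < f x}) :
    (volume.withDensity fun x => ENNReal.ofReal (f x)) (interior {x | 0 < f x})ᶜ = 0 := by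
  rw [withDensity_apply _ isOpen_interior.measurableSet.compl]
  have h0 : ∀ᵐ x, x ∉ frontier {x | 0 < f x} :=
    measure_eq_zero_iff_ae_notMem.1 (hS.addHaar_frontier volume)
  rw [setLIntegral_congr_fun_ae (g := fun _ => 0) isOpen_interior.measurableSet.compl ?_,
    lintegral_zero]
  filter_upwards [h0] with x hx hxU
  have hxS : x ∉ {x | 0 < f x} := fun hxS => hx ⟨subset_closure hxS, hxU⟩
  exact ENNReal.ofReal_of_nonpos (not_lt.1 hxS)

variable {μ : Measure ℝ} [IsProbabilityMeasure μ]

lemma hasDerivAt_cdf_of_continuousOn (hf0 : ∀ x, 0 ≤ f x)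
    (hμ : μ = volume.withDensity fun x => ENNReal.ofReal (f x)) {U : Set ℝ} (hU : IsOpen U)
    (hfU : ContinuousOn f U) {x : ℝ} (hx : x ∈ U) : HasDerivAt (cdf μ) (f x) x := by
  obtain ⟨ε, hε, hεU⟩ := Metric.isOpen_iff.1 hU x hx
  rw [Real.ball_eq_Ioo] at hεU
  have hsub : ∀ y < x + ε, Icc (x - ε / 2) y ⊆ U := fun y hy z hz =>
    hεU ⟨by linarith [hz.1], by linarith [hz.2]⟩
  have hint : ∀ y, x - ε / 2 ≤ y → y < x + ε → IntervalIntegrable f volume (x - ε / 2) y :=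
    fun y hy hy' => (hfU.mono (by rw [uIcc_of_le hy]; exact hsub y hy')).intervalIntegrable
  have heq : ∀ y, x - ε / 2 ≤ y → y < x + ε →
      cdf μ y = cdf μ (x - ε / 2) + ∫ z in (x - ε / 2)..y, f z := by
    intro y hy hy'
    have h1 : μ (Ioc (x - ε / 2) y) = ENNReal.ofReal (cdf μ y - cdf μ (x - ε / 2)) := by
      conv_lhs => rw [← measure_cdf μ]
      exact StieltjesFunction.measure_Ioc _ _ _
    have h2 : μ (Ioc (x - ε / 2) y) = ENNReal.ofReal (∫ z in (x - ε / 2)..y, f z) := by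
      conv_lhs => rw [hμ]
      rw [withDensity_apply _ measurableSet_Ioc, intervalIntegral.integral_of_le hy,
        ofReal_integral_eq_lintegral_ofReal (hint y hy hy').1 (.of_forall hf0)]
    rw [h1, ENNReal.ofReal_eq_ofReal_iff (sub_nonneg.2 (monotone_cdf μ hy))
      (intervalIntegral.integral_nonneg hy fun z _ => hf0 z)] at h2
    linarith
  have hd := (intervalIntegral.integral_hasDerivAt_right (hint x (by linarith) (by linarith))
    (hfU.stronglyMeasurableAtFilter hU x hx) (hfU.continuousAt (hU.mem_nhds hx))).const_add
      (cdf μ (x - ε / 2))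
  refine hd.congr_of_eventuallyEq ?_
  filter_upwards [Ioo_mem_nhds (show x - ε / 2 < x by linarith) (show x < x + ε by linarith)]
    with y hy using heq y hy.1.le hy.2

lemma cdf_quantile_of_absolutelyContinuous (hμ : μ ≪ volume) {u : ℝ} (hu : u ∈ Ioo (0 : ℝ) 1) :
    cdf μ (quantile μ u) = u := by
  refine le_antisymm ?_ (le_cdf_quantile hu)
  have h0 : (cdf μ).measure {quantile μ u} = 0 := by
    rw [measure_cdf]
    exact hμ (by simp)
  rw [StieltjesFunction.measure_singleton, ENNReal.ofReal_eq_zero] at h0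
  have : Function.leftLim (cdf μ) (quantile μ u) ≤ u := by
    refine le_of_tendsto ((monotone_cdf μ).tendsto_leftLim _) ?_
    filter_upwards [self_mem_nhdsWithin] with y hy
    exact ((lt_quantile_iff hu).1 hy).le
  linarith

theorem hasConcaveProfile_quantile (hf0 : ∀ x, 0 ≤ f x)
    (hμ : μ = volume.withDensity fun x => ENNReal.ofReal (f x))
    (hf : ∀ x y : ℝ, ∀ t ∈ Icc (0 : ℝ) 1, f x ^ (1 - t) * f y ^ t ≤ f ((1 - t) * x + t * y)) :
    HasConcaveProfile (quantile μ) := by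
  have hS := convex_support_of_logConcave hf
  have hfU := continuousOn_of_logConcave hf
  have hU0 : μ (interior {x | 0 < f x})ᶜ = 0 :=
    hμ ▸ withDensity_compl_interior_support hS
  have hUo : IsOpen (interior {x | 0 < f x}) := isOpen_interior
  have hUc : (interior {x | 0 < f x}).OrdConnected := hS.interior.ordConnected
  have hpos : ∀ x ∈ interior {x | 0 < f x}, 0 < f x := fun x hx =>
    interior_subset (s := {x | 0 < f x}) hx
  set U := interior {x | 0 < f x}
  have hF : ∀ x ∈ U, HasDerivAt (cdf μ) (f x) x := fun x hx =>
    hasDerivAt_cdf_of_continuousOn hf0 hμ hUo hfU hx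
  have hac : μ ≪ volume := hμ ▸ withDensity_absolutelyContinuous _ _
  have hFQ : ∀ u ∈ Ioo (0 : ℝ) 1, cdf μ (quantile μ u) = u := fun u hu =>
    cdf_quantile_of_absolutelyContinuous hac hu
  have hQU : ∀ u ∈ Ioo (0 : ℝ) 1, quantile μ u ∈ U := by
    intro u hu
    by_contra hQ
    have hcdf := hFQ u hu
    rw [cdf_eq_real] at hcdf
    by_cases hlow : ∃ x ∈ U, x ≤ quantile μ u
    · obtain ⟨x, hx, hxQ⟩ := hlow
      have hsub : (Iic (quantile μ u))ᶜ ⊆ Uᶜ := fun y hy hyU =>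
        hQ (hUc.out hx hyU ⟨hxQ, (not_le.1 (mem_Iic.not.1 hy)).le⟩)
      have h1 := (prob_compl_eq_zero_iff (μ := μ) measurableSet_Iic).1 (measure_mono_null hsub hU0)
      rw [measureReal_def, h1, ENNReal.toReal_one] at hcdf
      exact hu.2.ne' hcdf
    · push Not at hlow
      have hsub : Iic (quantile μ u) ⊆ Uᶜ := fun y hy hyU => (hlow y hyU).not_ge hy
      rw [measureReal_def, measure_mono_null hsub hU0, ENNReal.toReal_zero] at hcdf
      exact hu.1.ne hcdf
  have hQc : ∀ u ∈ Ioo (0 : ℝ) 1, ContinuousAt (quantile μ) u := by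
    intro u hu
    refine continuousAt_iff_continuous_left'_right'.2 ⟨tendsto_quantile_left hu, ?_⟩
    have hI : ∀ᶠ v in 𝓝[>] u, v ∈ Ioo (0 : ℝ) 1 ∧ u < v := by
      filter_upwards [Ioo_mem_nhdsGT hu.2] with v hv using ⟨⟨hu.1.trans hv.1, hv.2⟩, hv.1⟩
    refine tendsto_order.2 ⟨fun y hy => ?_, fun y hy => ?_⟩
    · filter_upwards [hI] with v hv
      exact hy.trans_le (monotoneOn_quantile hu hv.1 hv.2.le)
    · obtain ⟨z, hz, hzy⟩ := exists_between hy
      have hlt : u < cdf μ z := by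
        refine lt_of_le_of_ne ((quantile_le_iff hu).1 hz.le) fun hne => ?_
        have h1 : (cdf μ) =ᶠ[𝓝[>] (quantile μ u)] fun _ => u := by
          filter_upwards [Ioo_mem_nhdsGT hz] with w hw
          exact le_antisymm (hne ▸ monotone_cdf μ hw.2.le) ((quantile_le_iff hu).1 hw.1.le)
        have h2 : HasDerivWithinAt (cdf μ) 0 (Ioi (quantile μ u)) (quantile μ u) :=
          (hasDerivWithinAt_const _ _ u).congr_of_eventuallyEq h1 (hFQ u hu)
        have h3 := (uniqueDiffWithinAt_Ioi (quantile μ u)).eq_deriv _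
          (hF _ (hQU u hu)).hasDerivWithinAt h2
        exact (hpos _ (hQU u hu)).ne' h3
      filter_upwards [hI, Ioo_mem_nhdsGT hlt] with v hv hv'
      exact ((quantile_le_iff hv.1).2 hv'.2.le).trans_lt hzy
  have hQd : ∀ u ∈ Ioo (0 : ℝ) 1, HasDerivAt (quantile μ) (f (quantile μ u))⁻¹ u := fun u hu =>
    (hF _ (hQU u hu)).of_local_left_inverse (hQc u hu) (hpos _ (hQU u hu)).ne'
      (eventually_of_mem (isOpen_Ioo.mem_nhds hu) hFQ)
  refine ⟨fun u => f (quantile μ u), ?_, fun u hu => hpos _ (hQU u hu), hQd⟩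
  refine LinearOrder.concaveOn_of_lt (convex_Ioo 0 1) fun u₁ hu₁ u₂ hu₂ h12 a b ha hb hab => ?_
  have hD : Icc u₁ u₂ ⊆ Ioo (0 : ℝ) 1 := Icc_subset_Ioo hu₁.1 hu₂.2
  have hconc : ∀ s > 0, quantile μ u₂ + s ∈ U →
      ConcaveOn ℝ (Icc u₁ u₂) fun u => cdf μ (quantile μ u + s) := by
    intro s hs hsU
    have hmem : ∀ u ∈ Icc u₁ u₂, quantile μ u + s ∈ U := fun u hu =>
      hUc.out (hQU u (hD hu)) hsU
        ⟨by linarith, by linarith [monotoneOn_quantile (μ := μ) (hD hu) hu₂ hu.2]⟩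
    have hd : ∀ u ∈ Icc u₁ u₂, HasDerivAt (fun u => cdf μ (quantile μ u + s))
        (f (quantile μ u + s) * (f (quantile μ u))⁻¹) u := fun u hu =>
      (hF _ (hmem u hu)).comp u ((hQd u (hD hu)).add_const s)
    refine AntitoneOn.concaveOn_of_deriv (convex_Icc _ _)
      (fun u hu => (hd u hu).continuousAt.continuousWithinAt)
      (fun u hu => (hd u (interior_subset hu)).differentiableAt.differentiableWithinAt) ?_
    intro u hu v hv huv
    rw [(hd u (interior_subset hu)).deriv, (hd v (interior_subset hv)).deriv,
      ← div_eq_mul_inv, ← div_eq_mul_inv,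
      div_le_div_iff₀ (hpos _ (hQU _ (hD (interior_subset hv))))
        (hpos _ (hQU _ (hD (interior_subset hu))))]
    exact mul_add_le_add_mul_of_logConcave hf0 hf
      (monotoneOn_quantile (hD (interior_subset hu)) (hD (interior_subset hv)) huv) hs
  have hlim : ∀ u ∈ Ioo (0 : ℝ) 1, Tendsto (fun s => s⁻¹ * (cdf μ (quantile μ u + s) - u))
      (𝓝[>] 0) (𝓝 (f (quantile μ u))) := by
    intro u hu
    have := (hasDerivAt_iff_tendsto_slope_zero.1 (hF _ (hQU u hu))).mono_left
      (nhdsGT_le_nhdsNE 0)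
    simpa only [hFQ u hu, smul_eq_mul] using this
  have hm := convex_Ioo 0 1 hu₁ hu₂ ha.le hb.le hab
  refine le_of_tendsto_of_tendsto (((hlim u₁ hu₁).const_smul a).add ((hlim u₂ hu₂).const_smul b))
    (hlim _ hm) ?_
  have hsU : ∀ᶠ s in 𝓝[>] (0 : ℝ), quantile μ u₂ + s ∈ U := by
    have : Tendsto (fun s => quantile μ u₂ + s) (𝓝[>] (0 : ℝ)) (𝓝 (quantile μ u₂ + 0)) :=
      (tendsto_const_nhds.add tendsto_id).mono_left nhdsWithin_le_nhds
    rw [add_zero] at this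
    exact this.eventually (hUo.mem_nhds (hQU u₂ hu₂))
  filter_upwards [hsU, self_mem_nhdsWithin] with s hs hs0
  have hc := (hconc s hs0 hs).2 (left_mem_Icc.2 h12.le) (right_mem_Icc.2 h12.le) ha.le hb.le hab
  have := mul_le_mul_of_nonneg_left hc (inv_nonneg.2 (le_of_lt hs0))
  simp only [smul_eq_mul] at this ⊢
  linear_combination this

end LogConcaveDensity

section ConcaveProfile

variable {q : ℝ → ℝ}

lemma sq_div_le_of_le {A B c h₁ h₂ t : ℝ} (hA : 0 < A) (hB : 0 < B) (ht₀ : 0 ≤ t) (ht₁ : t ≤ 1)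
    (hc : (1 - t) * A + t * B ≤ c) (hM : 0 < (1 - t) * A + t * B) :
    ((1 - t) * h₁ + t * h₂) ^ 2 * c⁻¹ ≤ (1 - t) * h₁ ^ 2 * A⁻¹ + t * h₂ ^ 2 * B⁻¹ := by
  refine (mul_le_mul_of_nonneg_left (inv_anti₀ hM hc) (sq_nonneg _)).trans ?_
  have : (1 - t) * h₁ ^ 2 * A⁻¹ + t * h₂ ^ 2 * B⁻¹
      = ((1 - t) * h₁ ^ 2 * B + t * h₂ ^ 2 * A) / (A * B) := by
    field_simp
  rw [this, ← div_eq_mul_inv, div_le_div_iff₀ hM (by positivity)]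
  have h := mul_nonneg (mul_nonneg ht₀ (sub_nonneg.2 ht₁)) (sq_nonneg (h₂ * A - h₁ * B))
  linear_combination h

theorem HasConcaveProfile.incrementConvex (h : HasConcaveProfile q) : IncrementConvex q := by
  obtain ⟨I, hI, hpos, hd⟩ := h
  intro u₁ v₁ u₂ v₂ t hu₁ huv₁ hv₁ hu₂ huv₂ hv₂ ht₀ ht₁
  set H := (1 - t) * (v₁ - u₁) + t * (v₂ - u₂)
  have hline : ∀ u v, 0 < u → u ≤ v → v < 1 → ∀ τ ∈ Icc (0 : ℝ) 1,
      u + τ * (v - u) ∈ Ioo (0 : ℝ) 1 := by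
    intro u v hu huv hv τ hτ
    constructor <;> nlinarith [hτ.1, hτ.2, mul_nonneg hτ.1 (sub_nonneg.2 huv),
      mul_nonneg (sub_nonneg.2 hτ.2) (sub_nonneg.2 huv)]
  have hcomb : ∀ τ, (1 - t) * u₁ + t * u₂ + τ * H
      = (1 - t) * (u₁ + τ * (v₁ - u₁)) + t * (u₂ + τ * (v₂ - u₂)) := fun τ => by
    simp only [H]; ring
  have hcd : ∀ u k τ, u + τ * k ∈ Ioo (0 : ℝ) 1 →
      HasDerivAt (fun τ => q (u + τ * k)) ((I (u + τ * k))⁻¹ * k) τ := by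
    intro u k τ hτ
    have := (hd _ hτ).comp τ (((hasDerivAt_id' τ).mul_const k).const_add u)
    exact this.congr_deriv (by rw [one_mul])
  let ψ : ℝ → ℝ := fun τ => (1 - t) * (v₁ - u₁) * q (u₁ + τ * (v₁ - u₁)) +
    t * (v₂ - u₂) * q (u₂ + τ * (v₂ - u₂)) - H * q ((1 - t) * u₁ + t * u₂ + τ * H)
  have hmem : ∀ τ ∈ Icc (0 : ℝ) 1, (1 - t) * u₁ + t * u₂ + τ * H ∈ Ioo (0 : ℝ) 1 := by
    intro τ hτ
    rw [hcomb]
    exact convex_Ioo 0 1 (hline u₁ v₁ hu₁ huv₁ hv₁ τ hτ) (hline u₂ v₂ hu₂ huv₂ hv₂ τ hτ)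
      (by linarith) ht₀ (by ring)
  have hψ : ∀ τ ∈ Icc (0 : ℝ) 1, HasDerivAt ψ
      ((1 - t) * (v₁ - u₁) * ((I (u₁ + τ * (v₁ - u₁)))⁻¹ * (v₁ - u₁)) +
        t * (v₂ - u₂) * ((I (u₂ + τ * (v₂ - u₂)))⁻¹ * (v₂ - u₂)) -
        H * ((I ((1 - t) * u₁ + t * u₂ + τ * H))⁻¹ * H)) τ := fun τ hτ =>
    (((hcd _ _ τ (hline u₁ v₁ hu₁ huv₁ hv₁ τ hτ)).const_mul _).add
      ((hcd _ _ τ (hline u₂ v₂ hu₂ huv₂ hv₂ τ hτ)).const_mul _)).sub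
      ((hcd _ _ τ (hmem τ hτ)).const_mul _)
  have hmono : MonotoneOn ψ (Icc 0 1) := by
    refine monotoneOn_of_deriv_nonneg (convex_Icc _ _)
      (fun τ hτ => (hψ τ hτ).continuousAt.continuousWithinAt)
      (fun τ hτ => (hψ τ (interior_subset hτ)).differentiableAt.differentiableWithinAt) ?_
    intro τ hτ'
    have hτ : τ ∈ Icc (0 : ℝ) 1 := interior_subset hτ'
    rw [(hψ τ hτ).deriv]
    have m₁ := hline u₁ v₁ hu₁ huv₁ hv₁ τ hτ
    have m₂ := hline u₂ v₂ hu₂ huv₂ hv₂ τ hτ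
    have hc := hI.2 m₁ m₂ (sub_nonneg.2 ht₁) ht₀ (by ring)
    simp only [smul_eq_mul, ← hcomb] at hc
    have hM := convex_Ioi (0 : ℝ) (hpos _ m₁) (hpos _ m₂) (sub_nonneg.2 ht₁) ht₀ (by ring)
    have := sq_div_le_of_le (h₁ := v₁ - u₁) (h₂ := v₂ - u₂) (hpos _ m₁) (hpos _ m₂) ht₀ ht₁ hc hM
    linear_combination this
  have h01 := hmono (left_mem_Icc.2 zero_le_one) (right_mem_Icc.2 zero_le_one) zero_le_one
  have e1 : (1 - t) * u₁ + t * u₂ + H = (1 - t) * v₁ + t * v₂ := by simp only [H]; ring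
  simp only [ψ, zero_mul, one_mul, add_zero, add_sub_cancel, e1] at h01
  linear_combination h01

lemma memLp_log {p : ℝ} (hp : 1 ≤ p) :
    MemLp Real.log (ENNReal.ofReal p) (volume.restrict (Ioo (0 : ℝ) 1)) := by
  have hp0 : 0 < p := by linarith
  have hε : 0 < 1 / (2 * p) := by positivity
  have hpow : MemLp (fun x : ℝ => x ^ (-(1 / (2 * p)))) (ENNReal.ofReal p)
      (volume.restrict (Ioo (0 : ℝ) 1)) := by
    have hm : AEStronglyMeasurable (fun x : ℝ => x ^ (-(1 / (2 * p))))
        (volume.restrict (Ioo (0 : ℝ) 1)) :=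
      (measurable_id.pow_const _).aestronglyMeasurable
    rw [← integrable_norm_rpow_iff hm (by simpa using hp0) ENNReal.ofReal_ne_top,
      ENNReal.toReal_ofReal hp0.le]
    have hi : IntegrableOn (fun x : ℝ => x ^ (-(1 / 2) : ℝ)) (Ioo 0 1) :=
      (intervalIntegral.intervalIntegrable_rpow' (by norm_num)).1.mono_set Ioo_subset_Ioc_self
    refine hi.congr_fun (fun x hx => ?_) measurableSet_Ioo
    simp only
    rw [Real.norm_of_nonneg (Real.rpow_nonneg hx.1.le _), ← Real.rpow_mul hx.1.le]
    congr 1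
    field_simp
  refine (hpow.const_mul (1 / (2 * p))⁻¹).mono Real.measurable_log.aestronglyMeasurable ?_
  filter_upwards [ae_restrict_mem measurableSet_Ioo] with x hx
  have h1 := Real.log_le_rpow_div (inv_nonneg.2 hx.1.le) hε
  rw [Real.log_inv, Real.inv_rpow hx.1.le, ← Real.rpow_neg hx.1.le] at h1
  have h2 := Real.log_neg hx.1 hx.2
  rw [Real.norm_eq_abs, abs_of_neg h2, Real.norm_of_nonneg
    (mul_nonneg (inv_nonneg.2 hε.le) (Real.rpow_nonneg hx.1.le _)), mul_comm, ← div_eq_mul_inv]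
  exact h1

lemma memLp_log_one_sub {p : ℝ} (hp : 1 ≤ p) :
    MemLp (fun x => Real.log (1 - x)) (ENNReal.ofReal p) (volume.restrict (Ioo (0 : ℝ) 1)) := by
  have h := (Measure.measurePreserving_sub_left (volume : Measure ℝ) 1).restrict_preimage
    (measurableSet_Ioo (a := (0 : ℝ)) (b := 1))
  have hset : (fun x : ℝ => 1 - x) ⁻¹' Ioo 0 1 = Ioo 0 1 := by simp
  rw [hset] at h
  exact (memLp_log hp).comp_measurePreserving h

theorem HasConcaveProfile.memLp (h : HasConcaveProfile q) {p : ℝ} (hp : 1 ≤ p) :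
    MemLp q (ENNReal.ofReal p) (volume.restrict (Ioo (0 : ℝ) 1)) := by
  obtain ⟨I, hI, hpos, hd⟩ := h
  have hhalf : (1 / 2 : ℝ) ∈ Ioo (0 : ℝ) 1 := by norm_num
  have hmono : MonotoneOn q (Ioo 0 1) :=
    monotoneOn_of_deriv_nonneg (convex_Ioo _ _)
      (fun u hu => (hd u hu).continuousAt.continuousWithinAt)
      (fun u hu => (hd u (interior_subset hu)).differentiableAt.differentiableWithinAt)
      (fun u hu => by
        rw [(hd u (interior_subset hu)).deriv]
        exact (inv_pos.2 (hpos u (interior_subset hu))).le)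
  set K := 2 / I (1 / 2) with hK_def
  have hI0 := hpos _ hhalf
  have hK : 0 < K := by positivity
  let L : ℝ → ℝ := fun u => Real.log u - Real.log (1 - u)
  have hL : ∀ u ∈ Ioo (0 : ℝ) 1, HasDerivAt L (u⁻¹ + (1 - u)⁻¹) u := by
    intro u hu
    have h1 := ((hasDerivAt_id u).const_sub 1).log (sub_pos.2 hu.2).ne'
    refine ((Real.hasDerivAt_log hu.1.ne').sub h1).congr_deriv ?_
    simp only [id]
    ring
  have hIlow : ∀ u ∈ Ioo (0 : ℝ) 1, u * (1 - u) * (I (1 / 2) / 2) ≤ I u := by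
    intro u hu
    have h1 := hI.mul_le_of_nonneg (fun u hu => (hpos u hu).le) hu.1 hu.2 hhalf
      (left_mem_Icc.2 le_rfl : u ∈ Icc u u)
    have h2 : u * (1 - u) ≤ min u (1 - u) :=
      le_min (by nlinarith [hu.1, hu.2]) (by nlinarith [hu.1, hu.2])
    nlinarith
  have hderiv : ∀ u ∈ Ioo (0 : ℝ) 1, (I u)⁻¹ ≤ K * (u⁻¹ + (1 - u)⁻¹) := by
    intro u hu
    have h1 : 0 < 1 - u := sub_pos.2 hu.2
    have h0 := hu.1
    have h2 : 0 < u * (1 - u) * (I (1 / 2) / 2) := by positivity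
    refine (inv_anti₀ h2 (hIlow u hu)).trans (le_of_eq ?_)
    rw [hK_def]
    field_simp
    ring
  have hW : MonotoneOn (fun u => K * L u - q u) (Ioo 0 1) := by
    have hWd : ∀ u ∈ Ioo (0 : ℝ) 1, HasDerivAt (fun u => K * L u - q u)
        (K * (u⁻¹ + (1 - u)⁻¹) - (I u)⁻¹) u := fun u hu => ((hL u hu).const_mul K).sub (hd u hu)
    exact monotoneOn_of_deriv_nonneg (convex_Ioo _ _)
      (fun u hu => (hWd u hu).continuousAt.continuousWithinAt)
      (fun u hu => (hWd u (interior_subset hu)).differentiableAt.differentiableWithinAt)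
      (fun u hu => by
        rw [(hWd u (interior_subset hu)).deriv]
        exact sub_nonneg.2 (hderiv u (interior_subset hu)))
  have hLhalf : L (1 / 2) = 0 := by
    simp only [L]
    norm_num
  have hLp : MemLp (fun u => K * L u) (ENNReal.ofReal p) (volume.restrict (Ioo (0 : ℝ) 1)) :=
    ((memLp_log hp).sub (memLp_log_one_sub hp)).const_mul K
  have hdiff : MemLp (fun u => q u - q (1 / 2)) (ENNReal.ofReal p)
      (volume.restrict (Ioo (0 : ℝ) 1)) := by
    refine hLp.mono ((aemeasurable_restrict_of_monotoneOn measurableSet_Ioo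
      hmono).aestronglyMeasurable.sub aestronglyMeasurable_const) ?_
    filter_upwards [ae_restrict_mem measurableSet_Ioo] with u hu
    simp only [Real.norm_eq_abs]
    rcases le_total u (1 / 2) with h | h
    · have h1 := hmono hu hhalf h
      have h2 := hW hu hhalf h
      simp only [hLhalf, mul_zero] at h2
      rw [abs_of_nonpos (by linarith), abs_of_nonpos (by linarith)]
      linarith
    · have h1 := hmono hhalf hu h
      have h2 := hW hhalf hu h
      simp only [hLhalf, mul_zero] at h2
      rw [abs_of_nonneg (by linarith), abs_of_nonneg (by linarith)]
      linarith
  exact (memLp_congr_ae (.of_forall fun u => by simp)).1 (hdiff.add (memLp_const (q (1 / 2))))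

end ConcaveProfile

section Flc

variable {μ : Measure ℝ}

lemma quantile_dirac {x u : ℝ} (hu : u ∈ Ioo (0 : ℝ) 1) : quantile (Measure.dirac x) u = x := by
  refine eq_of_forall_ge_iff fun y => ?_
  rw [quantile_le_iff hu, cdf_eq_real, measureReal_def]
  by_cases h : x ≤ y
  · simp [h, hu.2.le]
  · simp [h, hu.1]

lemma incrementConvex_quantile_of_mem_Flc (hμ : μ ∈ Flc) : IncrementConvex (quantile μ) := by
  obtain ⟨_, ⟨x, rfl⟩ | ⟨f, hf0, hμf, hf⟩⟩ := hμ
  · have h0 : IncrementConvex fun _ => (0 : ℝ) := by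
      intro u₁ v₁ u₂ v₂ t
      simp
    have h1 : IncrementConvex fun _ => x := by
      intro u₁ v₁ u₂ v₂ t
      simp
    exact h0.of_eq_combination zero_le_one zero_le_one h1 fun u hu => by
      rw [quantile_dirac hu]; ring
  · exact (hasConcaveProfile_quantile hf0 hμf hf).incrementConvex

lemma memLp_quantile_of_mem_Flc (hμ : μ ∈ Flc) {p : ℝ} (hp : 1 ≤ p) :
    MemLp (quantile μ) (ENNReal.ofReal p) (volume.restrict (Ioo (0 : ℝ) 1)) := by
  obtain ⟨_, ⟨x, rfl⟩ | ⟨f, hf0, hμf, hf⟩⟩ := hμ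
  · refine (memLp_congr_ae ?_).2 (memLp_const x)
    filter_upwards [ae_restrict_mem measurableSet_Ioo] with u hu using quantile_dirac hu
  · exact (hasConcaveProfile_quantile hf0 hμf hf).memLp hp

theorem displacementConvex_Flc : DisplacementConvex Flc := by
  intro μ hμ ν hν t ht
  have := hμ.1
  have := hν.1
  have hmono : MonotoneOn (fun u => (1 - t) * quantile μ u + t * quantile ν u) (Ioo 0 1) :=
    fun u hu v hv huv => add_le_add
      (mul_le_mul_of_nonneg_left (monotoneOn_quantile hu hv huv) (sub_nonneg.2 ht.2))
      (mul_le_mul_of_nonneg_left (monotoneOn_quantile hu hv huv) ht.1)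
  obtain ⟨σ, hσ, hq⟩ := exists_quantile_eq hmono fun u hu =>
    ((tendsto_quantile_left hu).const_mul _).add ((tendsto_quantile_left hu).const_mul _)
  have hconv : IncrementConvex (quantile σ) :=
    (incrementConvex_quantile_of_mem_Flc hμ).of_eq_combination (sub_nonneg.2 ht.2) ht.1
      (incrementConvex_quantile_of_mem_Flc hν) hq
  exact ⟨σ, ⟨hσ, hconv.isLogConcave⟩, hq⟩

lemma memLp_quantile_of_hasFiniteMomentP {p : ℝ} (hp : 1 ≤ p) (hμ : HasFiniteMomentP p μ) :
    MemLp (quantile μ) (ENNReal.ofReal p) (volume.restrict (Ioo (0 : ℝ) 1)) := by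
  obtain ⟨_, hint⟩ := hμ
  have hp0 : 0 < p := by linarith
  have hm : AEMeasurable (quantile μ) (volume.restrict (Ioo (0 : ℝ) 1)) :=
    aemeasurable_restrict_of_monotoneOn measurableSet_Ioo monotoneOn_quantile
  rw [← integrable_norm_rpow_iff hm.aestronglyMeasurable (by simpa using hp0)
    ENNReal.ofReal_ne_top, ENNReal.toReal_ofReal hp0.le]
  rw [← map_quantile (μ := μ)] at hint
  exact hint.comp_aemeasurable hm

/-- Convergence of `W_p` distances gives almost everywhere convergence of the quantile functions
along a subsequence. -/
lemma exists_subseq_tendsto_quantile {p : ℝ} (hp : 1 ≤ p) {μs : ℕ → Measure ℝ}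
    (hs : ∀ n, MemLp (quantile (μs n)) (ENNReal.ofReal p) (volume.restrict (Ioo (0 : ℝ) 1)))
    (hμ : MemLp (quantile μ) (ENNReal.ofReal p) (volume.restrict (Ioo (0 : ℝ) 1)))
    (hW : Tendsto (fun n => Wdist p (μs n) μ) atTop (𝓝 0)) :
    ∃ ns : ℕ → ℕ, ∀ᵐ u ∂(volume.restrict (Ioo (0 : ℝ) 1)),
      Tendsto (fun n => quantile (μs (ns n)) u) atTop (𝓝 (quantile μ u)) := by
  have hp0 : 0 < p := by linarith
  have hpne : ENNReal.ofReal p ≠ 0 := by simpa using hp0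
  have hnorm : ∀ n, eLpNorm (quantile (μs n) - quantile μ) (ENNReal.ofReal p)
      (volume.restrict (Ioo (0 : ℝ) 1)) = ENNReal.ofReal (Wdist p (μs n) μ) := by
    intro n
    rw [((hs n).sub hμ).eLpNorm_eq_integral_rpow_norm hpne ENNReal.ofReal_ne_top,
      ENNReal.toReal_ofReal hp0.le, Wdist, one_div]
    rfl
  have hlim : Tendsto (fun n => eLpNorm (quantile (μs n) - quantile μ) (ENNReal.ofReal p)
      (volume.restrict (Ioo (0 : ℝ) 1))) atTop (𝓝 0) := by
    simp only [hnorm]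
    have := (ENNReal.continuous_ofReal.tendsto 0).comp hW
    rw [ENNReal.ofReal_zero] at this
    exact this
  obtain ⟨ns, -, h⟩ := (tendstoInMeasure_of_tendsto_eLpNorm hpne
    (fun n => (hs n).aestronglyMeasurable) hμ.aestronglyMeasurable hlim).exists_seq_tendsto_ae
  exact ⟨ns, h⟩

lemma eventually_sub_left_of_ae {P : ℝ → Prop} (hP : ∀ᵐ u ∂(volume.restrict (Ioo (0 : ℝ) 1)), P u)
    {w : ℝ} (hw : w ∈ Ioo (0 : ℝ) 1) :
    ∀ᵐ ε ∂(volume : Measure ℝ), ε ∈ Ioo 0 w → P (w - ε) := by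
  rw [ae_restrict_iff' measurableSet_Ioo] at hP
  have := (Measure.measurePreserving_sub_left (volume : Measure ℝ) w).quasiMeasurePreserving.ae hP
  filter_upwards [this] with ε hε hεw
  exact hε ⟨by linarith [hεw.2], by linarith [hεw.1, hw.2]⟩

/-- An almost everywhere limit of increment convex functions is increment convex as soon as it is
left-continuous. -/
lemma IncrementConvex.of_tendsto_ae {qs : ℕ → ℝ → ℝ} {q : ℝ → ℝ} (hqs : ∀ n, IncrementConvex (qs n))
    (hlim : ∀ᵐ u ∂(volume.restrict (Ioo (0 : ℝ) 1)), Tendsto (fun n => qs n u) atTop (𝓝 (q u)))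
    (hl : ∀ u ∈ Ioo (0 : ℝ) 1, Tendsto q (𝓝[<] u) (𝓝 (q u))) : IncrementConvex q := by
  intro u₁ v₁ u₂ v₂ t hu₁ huv₁ hv₁ hu₂ huv₂ hv₂ ht₀ ht₁
  have mu₁ : u₁ ∈ Ioo (0 : ℝ) 1 := ⟨hu₁, by linarith⟩
  have mv₁ : v₁ ∈ Ioo (0 : ℝ) 1 := ⟨by linarith, hv₁⟩
  have mu₂ : u₂ ∈ Ioo (0 : ℝ) 1 := ⟨hu₂, by linarith⟩
  have mv₂ : v₂ ∈ Ioo (0 : ℝ) 1 := ⟨by linarith, hv₂⟩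
  have mu : (1 - t) * u₁ + t * u₂ ∈ Ioo (0 : ℝ) 1 :=
    convex_Ioo 0 1 mu₁ mu₂ (by linarith) ht₀ (by ring)
  have mv : (1 - t) * v₁ + t * v₂ ∈ Ioo (0 : ℝ) 1 :=
    convex_Ioo 0 1 mv₁ mv₂ (by linarith) ht₀ (by ring)
  have hae : ∀ᵐ ε ∂(volume : Measure ℝ), 0 < ε → ε < u₁ → ε < u₂ →
      ((1 - t) * (v₁ - u₁) + t * (v₂ - u₂)) *
          (q ((1 - t) * v₁ + t * v₂ - ε) - q ((1 - t) * u₁ + t * u₂ - ε)) ≤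
        (1 - t) * (v₁ - u₁) * (q (v₁ - ε) - q (u₁ - ε)) +
          t * (v₂ - u₂) * (q (v₂ - ε) - q (u₂ - ε)) := by
    filter_upwards [eventually_sub_left_of_ae hlim mu₁, eventually_sub_left_of_ae hlim mv₁,
      eventually_sub_left_of_ae hlim mu₂, eventually_sub_left_of_ae hlim mv₂,
      eventually_sub_left_of_ae hlim mu, eventually_sub_left_of_ae hlim mv]
      with ε a₁ b₁ a₂ b₂ a b hε h₁ h₂
    have hεu : ε < (1 - t) * u₁ + t * u₂ := by
      have := convex_Ioi ε h₁ h₂ (sub_nonneg.2 ht₁) ht₀ (by ring)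
      exact this
    have hεv : (1 - t) * u₁ + t * u₂ ≤ (1 - t) * v₁ + t * v₂ := by nlinarith
    specialize a₁ ⟨hε, h₁⟩
    specialize b₁ ⟨hε, by linarith⟩
    specialize a₂ ⟨hε, h₂⟩
    specialize b₂ ⟨hε, by linarith⟩
    specialize a ⟨hε, hεu⟩
    specialize b ⟨hε, by linarith⟩
    refine le_of_tendsto_of_tendsto ((b.sub a).const_mul _)
      (((b₁.sub a₁).const_mul _).add ((b₂.sub a₂).const_mul _)) (.of_forall fun n => ?_)
    have := hqs n (u₁ - ε) (v₁ - ε) (u₂ - ε) (v₂ - ε) t (by linarith) (by linarith) (by linarith)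
      (by linarith) (by linarith) (by linarith) ht₀ ht₁
    rw [show (1 - t) * (v₁ - ε) + t * (v₂ - ε) = (1 - t) * v₁ + t * v₂ - ε by ring,
      show (1 - t) * (u₁ - ε) + t * (u₂ - ε) = (1 - t) * u₁ + t * u₂ - ε by ring] at this
    simpa only [sub_sub_sub_cancel_right] using this
  have hl' : ∀ u ∈ Ioo (0 : ℝ) 1, Tendsto (fun ε => q (u - ε)) (𝓝[>] 0) (𝓝 (q u)) := by
    intro u hu
    refine (hl u hu).comp (tendsto_nhdsWithin_iff.2 ⟨?_, ?_⟩)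
    · have : Tendsto (fun ε => u - ε) (𝓝[>] (0 : ℝ)) (𝓝 (u - 0)) :=
        (tendsto_const_nhds.sub tendsto_id).mono_left nhdsWithin_le_nhds
      rwa [sub_zero] at this
    · filter_upwards [self_mem_nhdsWithin] with ε hε
      exact sub_lt_self _ (mem_Ioi.1 hε)
  have hfreq : ∃ᶠ ε in 𝓝[>] (0 : ℝ), ((1 - t) * (v₁ - u₁) + t * (v₂ - u₂)) *
          (q ((1 - t) * v₁ + t * v₂ - ε) - q ((1 - t) * u₁ + t * u₂ - ε)) ≤
        (1 - t) * (v₁ - u₁) * (q (v₁ - ε) - q (u₁ - ε)) +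
          t * (v₂ - u₂) * (q (v₂ - ε) - q (u₂ - ε)) := by
    intro hev
    obtain ⟨δ, hδ, hsub⟩ := mem_nhdsGT_iff_exists_Ioo_subset.1 hev
    have hδ0 : (0 : ℝ) < δ := hδ
    have hm : 0 < min δ (min u₁ u₂) := lt_min hδ0 (lt_min hu₁ hu₂)
    have hvol : (volume : Measure ℝ) (Ioo 0 (min δ (min u₁ u₂))) ≠ 0 := by
      simpa using hm
    obtain ⟨ε, hε, hle⟩ := ((frequently_ae_mem_iff.2 hvol).and_eventually hae).exists
    obtain ⟨hεδ, hεu⟩ := lt_min_iff.1 hε.2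
    obtain ⟨hεu₁, hεu₂⟩ := lt_min_iff.1 hεu
    exact hsub ⟨hε.1, hεδ⟩ (hle hε.1 hεu₁ hεu₂)
  exact le_of_tendsto_of_tendsto_of_frequently (((hl' _ mv).sub (hl' _ mu)).const_mul _)
    ((((hl' _ mv₁).sub (hl' _ mu₁)).const_mul _).add (((hl' _ mv₂).sub (hl' _ mu₂)).const_mul _))
    hfreq

theorem wClosed_Flc {p : ℝ} (hp : 1 ≤ p) : WClosed p Flc := by
  intro μs μ hs hμ hW
  have := hμ.1
  obtain ⟨ns, hns⟩ := exists_subseq_tendsto_quantile hp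
    (fun n => memLp_quantile_of_mem_Flc (hs n) hp) (memLp_quantile_of_hasFiniteMomentP hp hμ) hW
  exact ⟨hμ.1, (IncrementConvex.of_tendsto_ae
    (fun n => incrementConvex_quantile_of_mem_Flc (hs (ns n))) hns
    fun u hu => tendsto_quantile_left hu).isLogConcave⟩

end Flc

/-- Proposition 4.2. The set `F_lc` of log-concave probability
measures on `ℝ` is displacement convex, and for every `p ∈ [1, ∞)` it is closed in
`P_p(ℝ)` with respect to the `p`-Wasserstein distance. -/
theorem Flc_displacementConvex_and_closed :
    DisplacementConvex Flc ∧ ∀ p : ℝ, 1 ≤ p → WClosed p Flc := by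
  exact ⟨displacementConvex_Flc, fun _ hp => wClosed_Flc hp⟩
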